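/- Let D be a Prüfer domain. Then D is universally Japanese if and only if for every prime ideal 𝔭 of D and every n ≥ 0, the polynomial ring (D/𝔭)[x_1,…,x_n] is N-2. -/

import Mathlib

set_option synthInstance.maxHeartbeats 400000
set_option maxHeartbeats 800000

universe u

/-- An integral domain `S` is N-1 if the integral closure of `S` in its fraction
field is a finitely generated `S`-module. -/
def IsN1 (S : Type u) [CommRing S] [IsDomain S] : Prop :=
  Module.Finite S (integralClosure S (FractionRing S))

/-- An integral domain `S` is N-2 (Japanese) if for every finite field extension `L`
of its fraction field, the integral closure of `S` in `L` is a finitely generated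
`S`-module. -/
def IsN2 (S : Type u) [CommRing S] [IsDomain S] : Prop :=
  ∀ (L : Type u) [Field L] [Algebra S L] [Algebra (FractionRing S) L]
    [IsScalarTower S (FractionRing S) L],
    FiniteDimensional (FractionRing S) L → Module.Finite S (integralClosure S L)

/-- A commutative ring `R` is universally Japanese if every finite type `R`-algebra
that is an integral domain is N-1. -/
def UniversallyJapanese (R : Type u) [CommRing R] : Prop :=
  ∀ (A : Type u) [CommRing A] [IsDomain A] [Algebra R A],
    Algebra.FiniteType R A → IsN1 A

/-- A Prüfer domain is an integral domain whose localization at every prime ideal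
is a valuation ring. -/
def IsPruferDomain (D : Type u) [CommRing D] [IsDomain D] : Prop :=
  ∀ (P : Ideal D) [P.IsPrime], ValuationRing (Localization.AtPrime P)

section Fiber

open TensorProduct

theorem weaklyQuasiFiniteAt_of_quasiFinite_fiber {R S A : Type*} [CommRing R] [CommRing S]
    [CommRing A] [Algebra R S] [Algebra S A] [Algebra R A] [IsScalarTower R S A]
    (p : Ideal R) [p.IsPrime] (q : Ideal A) [q.IsPrime] [q.LiesOver p]
    [Algebra S (p.Fiber A)]
    (h : ∀ s : S, algebraMap S (p.Fiber A) s = 1 ⊗ₜ algebraMap S A s)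
    [Algebra.QuasiFinite S (p.Fiber A)] : Algebra.WeaklyQuasiFiniteAt S q := by
  rw [Algebra.weaklyQuasiFiniteAt_iff]
  let T := Localization.AtPrime q ⧸ (q.under S).map (algebraMap S (Localization.AtPrime q))
  let φ₁ : p.ResidueField →ₐ[R] T := Ideal.ResidueField.liftₐ p (Algebra.ofId R T)
    (fun r hr ↦ by
      have hrS : algebraMap R S r ∈ q.under S := by
        rw [Ideal.mem_comap, ← IsScalarTower.algebraMap_apply, ← Ideal.mem_comap]
        rwa [Ideal.over_def q p] at hr
      rw [RingHom.mem_ker]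
      change algebraMap R T r = 0
      rw [IsScalarTower.algebraMap_apply R (Localization.AtPrime q) T,
        IsScalarTower.algebraMap_apply R S (Localization.AtPrime q)]
      exact Ideal.Quotient.eq_zero_iff_mem.mpr (Ideal.mem_map_of_mem _ hrS))
    (fun r hr ↦ by
      change IsUnit (algebraMap R T r)
      have hrA : algebraMap R A r ∉ q := by
        rw [← Ideal.mem_comap]
        rwa [Ideal.mem_primeCompl_iff, Ideal.over_def q p] at hr
      rw [IsScalarTower.algebraMap_apply R (Localization.AtPrime q) T,
        IsScalarTower.algebraMap_apply R A (Localization.AtPrime q)]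
      exact (IsLocalization.map_units (M := q.primeCompl) (Localization.AtPrime q)
        ⟨_, hrA⟩).map _)
  let φ₂ : p.Fiber A →ₐ[R] T :=
    Algebra.TensorProduct.lift φ₁ (IsScalarTower.toAlgHom R A T) fun _ _ ↦ .all _ _
  have hφ (a : A) : φ₂ (1 ⊗ₜ a) = algebraMap A T a := by simp [φ₂]
  let φ : p.Fiber A →ₐ[S] T :=
    { φ₂ with
      commutes' s := by
        rw [h]
        exact (hφ _).trans (IsScalarTower.algebraMap_apply S A T s).symm }
  refine .of_forall_exists_mul_mem_range φ fun x ↦ ?_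
  obtain ⟨x, rfl⟩ := Ideal.Quotient.mk_surjective x
  obtain ⟨x, s, rfl⟩ := IsLocalization.exists_mk'_eq q.primeCompl x
  refine ⟨1 ⊗ₜ s.1, ?_, 1 ⊗ₜ x, ?_⟩
  · change IsUnit (φ₂ _)
    rw [hφ, IsScalarTower.algebraMap_apply A (Localization.AtPrime q) T]
    exact (IsLocalization.map_units (M := q.primeCompl) (Localization.AtPrime q) s).map _
  · change φ₂ _ = _ * φ₂ _
    rw [hφ, hφ, IsScalarTower.algebraMap_apply A (Localization.AtPrime q) T,
      IsScalarTower.algebraMap_apply A (Localization.AtPrime q) T, Ideal.Quotient.algebraMap_eq,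
      ← map_mul, IsLocalization.mk'_spec]

theorem exists_forall_dvd_of_valuationRing {V ι : Type*} [CommRing V] [IsDomain V]
    [ValuationRing V] (s : Finset ι) (hs : s.Nonempty) (f : ι → V) :
    ∃ i ∈ s, ∀ j ∈ s, f i ∣ f j := by
  induction hs using Finset.Nonempty.cons_induction with
  | singleton a => exact ⟨a, by simp⟩
  | cons a s ha hs ih =>
    obtain ⟨i, hi, h⟩ := ih
    rcases ValuationRing.dvd_total (f a) (f i) with h' | h'
    · exact ⟨a, by simp, fun j hj ↦ (Finset.mem_cons.mp hj).elim
        (by rintro rfl; rfl) fun hj ↦ h'.trans (h j hj)⟩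
    · exact ⟨i, by simp [hi], fun j hj ↦ (Finset.mem_cons.mp hj).elim
        (by rintro rfl; exact h') fun hj ↦ h j hj⟩

/-- A nonzero polynomial over a domain that is a valuation ring at `p` becomes, after multiplying
by an element outside `p`, a scalar multiple of a polynomial which is nonzero modulo `p`. -/
theorem MvPolynomial.exists_smul_eq_smul_of_valuationRing {R ι : Type*} [CommRing R] [IsDomain R]
    (p : Ideal R) [p.IsPrime] [ValuationRing (Localization.AtPrime p)]
    (g : MvPolynomial ι R) (hg : g ≠ 0) :
    ∃ (s c : R) (h : MvPolynomial ι R), c ≠ 0 ∧ s • g = c • h ∧ ∃ m, h.coeff m ∉ p := by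
  obtain ⟨m, hm, hdvd⟩ := exists_forall_dvd_of_valuationRing g.support
    (MvPolynomial.support_nonempty.mpr hg)
    fun m ↦ algebraMap R (Localization.AtPrime p) (g.coeff m)
  have key (j) (hj : j ∈ g.support) : ∃ t : R, t ∉ p ∧ ∃ b, t * g.coeff j = g.coeff m * b := by
    obtain ⟨x, hx⟩ := hdvd j hj
    obtain ⟨b, t, rfl⟩ := IsLocalization.exists_mk'_eq p.primeCompl x
    refine ⟨t, t.2, b, ?_⟩
    apply IsLocalization.injective (Localization.AtPrime p) p.primeCompl_le_nonZeroDivisors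
    rw [map_mul, map_mul, hx, ← IsLocalization.mk'_spec (Localization.AtPrime p) b t]
    ring
  choose! t htp b hb using key
  have hs : ∏ j ∈ g.support, t j ∉ p := by
    rw [Ideal.IsPrime.prod_mem_iff]
    push Not
    exact htp
  have hdvd : MvPolynomial.C (g.coeff m) ∣ (∏ j ∈ g.support, t j) • g := by
    rw [MvPolynomial.C_dvd_iff_dvd_coeff]
    intro j
    rw [MvPolynomial.coeff_smul, smul_eq_mul]
    by_cases hj : j ∈ g.support
    · exact Dvd.dvd.trans ⟨b j, hb j hj⟩ (mul_dvd_mul_right (Finset.dvd_prod_of_mem _ hj) _)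
    · simp [MvPolynomial.notMem_support_iff.mp hj]
  obtain ⟨h, hh⟩ := hdvd
  have hm' : g.coeff m ≠ 0 := MvPolynomial.mem_support_iff.mp hm
  refine ⟨_, g.coeff m, h, hm', by rw [hh, MvPolynomial.smul_eq_C_mul], m, ?_⟩
  have := congr(($hh).coeff m)
  rw [MvPolynomial.coeff_smul, MvPolynomial.coeff_C_mul, smul_eq_mul, mul_comm] at this
  rwa [← mul_left_cancel₀ hm' this]

theorem algebraicIndependent_of_fiber {R A ι : Type*} [CommRing R] [IsDomain R] [CommRing A]
    [IsDomain A] [Algebra R A] [FaithfulSMul R A] (p : Ideal R) [p.IsPrime]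
    [ValuationRing (Localization.AtPrime p)] (y : ι → A)
    (hy : AlgebraicIndependent p.ResidueField fun i ↦ (1 ⊗ₜ y i : p.Fiber A)) :
    AlgebraicIndependent R y := by
  rw [algebraicIndependent_iff]
  intro g hg
  by_contra hg0
  obtain ⟨s, c, h, hc, hsh, m, hm⟩ := g.exists_smul_eq_smul_of_valuationRing p hg0
  have h0 : MvPolynomial.aeval y h = 0 := by
    have := congr(MvPolynomial.aeval y $hsh)
    rw [map_smul, map_smul, hg, smul_zero, eq_comm, Algebra.smul_def] at this
    exact (mul_eq_zero.mp this).resolve_left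
      ((map_ne_zero_iff _ (FaithfulSMul.algebraMap_injective R A)).mpr hc)
  have h1 : MvPolynomial.aeval (fun i ↦ (1 ⊗ₜ y i : p.Fiber A))
      (h.map (algebraMap R p.ResidueField)) = 0 := by
    rw [MvPolynomial.aeval_map_algebraMap, MvPolynomial.aeval_one_tmul, h0, tmul_zero]
  have h2 := congr(($(algebraicIndependent_iff.mp hy _ h1)).coeff m)
  rw [MvPolynomial.coeff_map, MvPolynomial.coeff_zero,
    Ideal.algebraMap_residueField_eq_zero] at h2
  exact hm h2

/-- A Noether normalization of a fibre can be lifted to the total space. -/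
theorem exists_noetherNormalization_fiber {R A : Type*} [CommRing R] [CommRing A] [Algebra R A]
    [Algebra.FiniteType R A] (p : Ideal R) [p.IsPrime] [Nontrivial (p.Fiber A)] :
    ∃ (d : ℕ) (y : Fin d → A),
      AlgebraicIndependent p.ResidueField (fun i ↦ (1 ⊗ₜ y i : p.Fiber A)) ∧
      (MvPolynomial.aeval (R := p.ResidueField) fun i ↦ (1 ⊗ₜ y i : p.Fiber A)).Finite := by
  obtain ⟨d, g, hinj, hfin⟩ := exists_finite_inj_algHom_of_fg p.ResidueField (p.Fiber A)
  choose r hrp y hy using fun i : Fin d ↦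
    Ideal.Fiber.exists_smul_eq_one_tmul p (g (MvPolynomial.X i))
  obtain ⟨u, hu, huy⟩ : ∃ u : Fin d → p.ResidueField, (∀ i, u i ≠ 0) ∧
      ∀ i, u i • g (MvPolynomial.X i) = 1 ⊗ₜ y i :=
    ⟨fun i ↦ algebraMap R p.ResidueField (r i),
      fun i ↦ by simpa [Ideal.algebraMap_residueField_eq_zero] using hrp i,
      fun i ↦ by rw [algebraMap_smul, hy]⟩
  let σ : MvPolynomial (Fin d) p.ResidueField →ₐ[p.ResidueField]
      MvPolynomial (Fin d) p.ResidueField :=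
    MvPolynomial.aeval fun i ↦ u i • MvPolynomial.X i
  let τ : MvPolynomial (Fin d) p.ResidueField →ₐ[p.ResidueField]
      MvPolynomial (Fin d) p.ResidueField :=
    MvPolynomial.aeval fun i ↦ (u i)⁻¹ • MvPolynomial.X i
  have hστ : σ.comp τ = AlgHom.id _ _ := by
    ext1 i
    simp [σ, τ, smul_smul, hu i]
  have hτσ : τ.comp σ = AlgHom.id _ _ := by
    ext1 i
    simp [σ, τ, smul_smul, hu i]
  have haeval : MvPolynomial.aeval (fun i ↦ (1 ⊗ₜ y i : p.Fiber A)) = g.comp σ := by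
    ext1 i
    simp [σ, ← huy]
  refine ⟨d, y, ?_, ?_⟩
  · rw [AlgebraicIndependent, haeval, AlgHom.coe_comp]
    exact hinj.comp (Function.LeftInverse.injective (g := τ) fun x ↦ DFunLike.congr_fun hτσ x)
  · rw [haeval]
    exact hfin.comp (AlgHom.Finite.of_surjective _
      (Function.RightInverse.surjective (g := τ) fun x ↦ DFunLike.congr_fun hστ x))

attribute [local instance] MvPolynomial.algebraMvPolynomial

theorem quasiFinite_mvPolynomial_residueField {R ι : Type*} [CommRing R] (p : Ideal R)
    [p.IsPrime] :
    Algebra.QuasiFinite (MvPolynomial ι R) (MvPolynomial ι p.ResidueField) := by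
  exact (Algebra.QuasiFinite.iff_of_algEquiv
    (Algebra.IsPushout.equiv R (MvPolynomial ι R) p.ResidueField
      (MvPolynomial ι p.ResidueField))).mp inferInstance

/-- Near each prime, a domain of finite type over a Prüfer domain is quasi-finite over a
polynomial ring. -/
theorem exists_algebraicIndependent_weaklyQuasiFiniteAt {R A : Type*} [CommRing R] [IsDomain R]
    [CommRing A] [IsDomain A] [Algebra R A] [FaithfulSMul R A] [Algebra.FiniteType R A]
    (q : Ideal A) [q.IsPrime] [ValuationRing (Localization.AtPrime (q.under R))] :
    ∃ (d : ℕ) (y : Fin d → A), AlgebraicIndependent R y ∧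
      letI := (MvPolynomial.aeval (R := R) y).toAlgebra
      Algebra.WeaklyQuasiFiniteAt (MvPolynomial (Fin d) R) q := by
  let p := q.under R
  have : Nontrivial (p.Fiber A) :=
    (PrimeSpectrum.preimageEquivFiber R A ⟨p, inferInstance⟩ ⟨⟨q, inferInstance⟩, rfl⟩).nontrivial
  obtain ⟨d, y, hind, hfin⟩ := exists_noetherNormalization_fiber (A := A) p
  refine ⟨d, y, algebraicIndependent_of_fiber p y hind, ?_⟩
  let := (MvPolynomial.aeval (R := R) y).toAlgebra
  have : IsScalarTower R (MvPolynomial (Fin d) R) A :=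
    .of_algebraMap_eq' (MvPolynomial.aeval (R := R) y).comp_algebraMap.symm
  let w := MvPolynomial.aeval (R := p.ResidueField) fun i ↦ (1 ⊗ₜ y i : p.Fiber A)
  let : Algebra (MvPolynomial (Fin d) p.ResidueField) (p.Fiber A) := w.toAlgebra
  let : Algebra (MvPolynomial (Fin d) R) (p.Fiber A) :=
    (w.toRingHom.comp (algebraMap _ (MvPolynomial (Fin d) p.ResidueField))).toAlgebra
  have : IsScalarTower (MvPolynomial (Fin d) R) (MvPolynomial (Fin d) p.ResidueField)
    (p.Fiber A) := .of_algebraMap_eq' rfl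
  have : Module.Finite (MvPolynomial (Fin d) p.ResidueField) (p.Fiber A) := hfin
  have := quasiFinite_mvPolynomial_residueField (ι := Fin d) p
  have : Algebra.QuasiFinite (MvPolynomial (Fin d) R) (p.Fiber A) :=
    .trans _ (MvPolynomial (Fin d) p.ResidueField) _
  refine weaklyQuasiFiniteAt_of_quasiFinite_fiber p q fun s ↦ ?_
  change w (MvPolynomial.map _ s) = 1 ⊗ₜ MvPolynomial.aeval y s
  rw [MvPolynomial.aeval_map_algebraMap, MvPolynomial.aeval_one_tmul]

end Fiber

theorem finiteDimensional_fractionRing_of_quasiFiniteAt {S A : Type*} [CommRing S] [IsDomain S]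
    [CommRing A] [IsDomain A] [Algebra S A]
    (q : Ideal A) [q.IsPrime] [Algebra.QuasiFiniteAt S q]
    [Algebra (FractionRing S) (FractionRing A)]
    [IsScalarTower S (FractionRing S) (FractionRing A)] :
    FiniteDimensional (FractionRing S) (FractionRing A) := by
  have : Algebra.QuasiFiniteAt S (⊥ : Ideal A) := .of_le (Q := q) bot_le
  have hbot : IsFractionRing A (Localization.AtPrime (⊥ : Ideal A)) := by
    rw [IsFractionRing, ← Ideal.primeCompl_bot]
    infer_instance
  have : Algebra.QuasiFinite S (FractionRing A) :=
    .of_surjective_algHom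
      ((FractionRing.algEquiv A (Localization.AtPrime (⊥ : Ideal A))).symm.restrictScalars
        S).toAlgHom (AlgEquiv.surjective _)
  have : Algebra.QuasiFinite (FractionRing S) (FractionRing A) := .of_restrictScalars S _ _
  exact .of_quasiFinite

theorem exists_pow_smul_isIntegral {S A L : Type*} [CommRing S] [CommRing A] [CommRing L]
    [Algebra S A] [Algebra A L] [Algebra S L] [IsScalarTower S A L] (f : A)
    (hf : ∀ x : A, ∃ m, IsIntegral S (f ^ m * x)) (c : L) (hc : IsIntegral A c) :
    ∃ k, IsIntegral S (f ^ k • c) := by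
  have hfint : IsIntegral S f := by
    obtain ⟨n, hn⟩ := hf f
    rw [← pow_succ] at hn
    exact hn.of_pow n.succ_pos
  choose m hm using hf
  obtain ⟨P, hP, hPc⟩ := hc
  let k := ∑ i ∈ Finset.range P.natDegree, m (P.coeff i)
  refine ⟨k, ?_⟩
  have hlift : P.scaleRoots (f ^ k) ∈ Polynomial.lifts (algebraMap (integralClosure S A) A) := by
    rw [Polynomial.lifts_iff_coeff_lifts]
    intro i
    suffices IsIntegral S ((P.scaleRoots (f ^ k)).coeff i) from ⟨⟨_, this⟩, rfl⟩
    rw [Polynomial.coeff_scaleRoots]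
    rcases lt_trichotomy i P.natDegree with hi | rfl | hi
    · have hle : m (P.coeff i) ≤ k := Finset.single_le_sum (f := fun i ↦ m (P.coeff i))
        (fun _ _ ↦ Nat.zero_le _) (Finset.mem_range.mpr hi)
      obtain ⟨a, ha⟩ := Nat.exists_eq_add_of_le hle
      obtain ⟨b, hb⟩ := Nat.exists_eq_add_of_lt hi
      have : P.coeff i * (f ^ k) ^ (P.natDegree - i) =
          f ^ m (P.coeff i) * P.coeff i * (f ^ a * (f ^ k) ^ b) := by
        rw [show P.natDegree - i = b + 1 by omega, pow_succ, ha, pow_add f]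
        ring
      rw [this]
      exact (hm _).mul ((hfint.pow _).mul ((hfint.pow _).pow _))
    · simpa [hP.leadingCoeff] using isIntegral_one
    · simpa [Polynomial.coeff_eq_zero_of_natDegree_lt hi] using isIntegral_zero
  obtain ⟨Q, hQ, -, hQm⟩ := Polynomial.lifts_and_natDegree_eq_and_monic hlift
    ((Polynomial.monic_scaleRoots_iff _).mpr hP)
  have hroot : IsIntegral (integralClosure S A) (f ^ k • c) := by
    refine ⟨Q, hQm, ?_⟩
    rw [IsScalarTower.algebraMap_eq (integralClosure S A) A L, ← Polynomial.eval₂_map, hQ,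
      Algebra.smul_def]
    exact Polynomial.scaleRoots_eval₂_eq_zero _ hPc
  exact isIntegral_trans _ hroot

theorem exists_fg_le_integralClosure_of_weaklyQuasiFiniteAt {S A : Type u} [CommRing S]
    [IsDomain S] [CommRing A] [IsDomain A] [Algebra S A] [FaithfulSMul S A]
    [Algebra.FiniteType S A] (hS : IsN2 S) (q : Ideal A) [q.IsPrime]
    [Algebra.WeaklyQuasiFiniteAt S q] :
    ∃ f ∉ q, ∃ N : Submodule A (FractionRing A), N.FG ∧
      N ≤ (integralClosure A (FractionRing A)).toSubmodule ∧
      ∀ c ∈ integralClosure A (FractionRing A), ∃ k, f ^ k • c ∈ N := by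
  have : Algebra.QuasiFiniteAt S q := .of_weaklyQuasiFiniteAt ..
  obtain ⟨f, hfq, hf⟩ := Algebra.zariskisMainProperty_iff'.mp
    (Algebra.ZariskisMainProperty.of_finiteType_of_weaklyQuasiFiniteAt (R := S) q)
  let : Algebra (FractionRing S) (FractionRing A) := FractionRing.liftAlgebra S (FractionRing A)
  have : IsScalarTower S (FractionRing S) (FractionRing A) :=
    FractionRing.isScalarTower_liftAlgebra S (FractionRing A)
  obtain ⟨s, hs⟩ := Module.Finite.iff_fg.mp
    (show Module.Finite S (integralClosure S (FractionRing A)).toSubmodule from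
      hS (FractionRing A) (finiteDimensional_fractionRing_of_quasiFiniteAt q))
  have hsub (x : FractionRing A) : x ∈ Submodule.span S (s : Set (FractionRing A)) ↔
      IsIntegral S x := by
    rw [hs]
    rfl
  refine ⟨f, hfq, Submodule.span A s, ⟨s, rfl⟩, Submodule.span_le.mpr fun x hx ↦ ?_, fun c hc ↦ ?_⟩
  · exact ((hsub x).mp (Submodule.subset_span hx)).tower_top
  · obtain ⟨k, hk⟩ := exists_pow_smul_isIntegral f hf c hc
    exact ⟨k, Submodule.span_le_restrictScalars S A _ ((hsub _).mpr hk)⟩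

theorem Submodule.fg_of_forall_isMaximal_exists_pow_smul_mem {A M : Type*} [CommRing A]
    [AddCommGroup M] [Module A M] (C : Submodule A M)
    (h : ∀ q : Ideal A, q.IsMaximal → ∃ f ∉ q, ∃ N : Submodule A M, N.FG ∧ N ≤ C ∧
      ∀ c ∈ C, ∃ k, f ^ k • c ∈ N) : C.FG := by
  let s : Set A := {f | ∃ N : Submodule A M, N.FG ∧ N ≤ C ∧ ∀ c ∈ C, ∃ k, f ^ k • c ∈ N}
  have hs : Ideal.span s = ⊤ := by
    by_contra hne
    obtain ⟨q, hq, hsq⟩ := Ideal.exists_le_maximal _ hne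
    obtain ⟨f, hfq, hf⟩ := h q hq
    exact hfq (hsq (Ideal.subset_span hf))
  obtain ⟨t, hts, ht⟩ := (Ideal.span_eq_top_iff_finite s).mp hs
  choose! N hNfg hNC hN using fun f (hf : f ∈ s) ↦ hf
  have hC : C = t.sup N := by
    refine le_antisymm (fun c hc ↦ ?_) (Finset.sup_le fun f hf ↦ hNC f (hts hf))
    refine Submodule.mem_of_span_eq_top_of_smul_pow_mem _ _ ht c fun f ↦ ?_
    obtain ⟨k, hk⟩ := hN f (hts f.2) c hc
    exact ⟨k, Finset.le_sup (f := N) f.2 hk⟩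
  rw [hC]
  exact Submodule.fg_finset_sup t N fun f hf ↦ hNfg f (hts hf)

theorem isN1_of_faithfulSMul_of_valuationRing {R A : Type u} [CommRing R] [IsDomain R]
    [CommRing A] [IsDomain A] [Algebra R A] [FaithfulSMul R A] [Algebra.FiniteType R A]
    (hR : IsPruferDomain R) (hN2 : ∀ n, IsN2 (MvPolynomial (Fin n) R)) : IsN1 A := by
  refine Module.Finite.iff_fg.mpr (Submodule.fg_of_forall_isMaximal_exists_pow_smul_mem
    (integralClosure A (FractionRing A)).toSubmodule fun q hq ↦ ?_)
  have := hR (q.under R)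
  obtain ⟨d, y, hy, hqf⟩ := exists_algebraicIndependent_weaklyQuasiFiniteAt (R := R) q
  let := (MvPolynomial.aeval (R := R) y).toAlgebra
  have : IsScalarTower R (MvPolynomial (Fin d) R) A :=
    .of_algebraMap_eq' (MvPolynomial.aeval (R := R) y).comp_algebraMap.symm
  have : FaithfulSMul (MvPolynomial (Fin d) R) A :=
    (faithfulSMul_iff_algebraMap_injective _ _).mpr hy
  have : Algebra.FiniteType (MvPolynomial (Fin d) R) A := .of_restrictScalars_finiteType R _ _
  exact exists_fg_le_integralClosure_of_weaklyQuasiFiniteAt (hN2 d) q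

theorem IsPruferDomain.quotient {D : Type u} [CommRing D] [IsDomain D] (hD : IsPruferDomain D)
    (p : Ideal D) [p.IsPrime] : IsPruferDomain (D ⧸ p) := by
  intro P _
  have := hD (P.comap (Ideal.Quotient.mk p))
  exact Function.Surjective.valuationRing
    (Localization.localRingHom _ P (Ideal.Quotient.mk p) rfl)
    (RingHom.surjectiveOnStalks_of_surjective Ideal.Quotient.mk_surjective P ‹_›)

theorem IsPruferDomain.universallyJapanese {D : Type u} [CommRing D] [IsDomain D]
    (hD : IsPruferDomain D)
    (h : ∀ (p : Ideal D) [p.IsPrime] (n : ℕ), IsN2 (MvPolynomial (Fin n) (D ⧸ p))) :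
    UniversallyJapanese D := by
  intro A _ _ _ _
  let p := RingHom.ker (algebraMap D A)
  have : p.IsPrime := RingHom.ker_isPrime _
  let : Algebra (D ⧸ p) A := (RingHom.kerLift (algebraMap D A)).toAlgebra
  have : IsScalarTower D (D ⧸ p) A := .of_algebraMap_eq' rfl
  have : FaithfulSMul (D ⧸ p) A :=
    (faithfulSMul_iff_algebraMap_injective _ _).mpr (RingHom.kerLift_injective _)
  have : Algebra.FiniteType (D ⧸ p) A := .of_restrictScalars_finiteType D _ _
  exact isN1_of_faithfulSMul_of_valuationRing (hD.quotient p) (h p)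

/-- A domain over which every module-finite domain is N-1 is N-2. -/
theorem isN2_of_forall_isN1 {S : Type u} [CommRing S] [IsDomain S]
    (h : ∀ (A : Type u) [CommRing A] [IsDomain A] [Algebra S A], Module.Finite S A → IsN1 A) :
    IsN2 S := by
  intro L _ _ _ _ _
  obtain ⟨s, b, hb⟩ := FiniteDimensional.exists_is_basis_integral S (FractionRing S) L
  let A := Algebra.adjoin S (Set.range b)
  have : Module.Finite S A := Module.Finite.iff_fg.mpr
    (fg_adjoin_of_finite (Set.finite_range b) (Set.forall_mem_range.mpr hb))
  have : IsFractionRing A L := by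
    refine .of_field _ _ fun x ↦ ?_
    obtain ⟨r, hr⟩ := IsLocalization.exist_integer_multiples_of_finite (nonZeroDivisors S)
      fun i ↦ b.repr x i
    choose a ha using hr
    have hxA : (r : S) • x ∈ A := by
      rw [← b.sum_repr x, Finset.smul_sum]
      refine sum_mem fun i _ ↦ ?_
      rw [← smul_assoc, ← ha, algebraMap_smul]
      exact A.smul_mem (Algebra.subset_adjoin ⟨i, rfl⟩) _
    have hr0 : algebraMap S L r ≠ 0 := by
      rw [IsScalarTower.algebraMap_apply S (FractionRing S) L]
      exact (map_ne_zero _).mpr (IsFractionRing.to_map_ne_zero_of_mem_nonZeroDivisors r.2)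
    refine ⟨⟨_, hxA⟩, algebraMap S A r, ?_⟩
    rw [eq_div_iff (by exact hr0), mul_comm, ← IsScalarTower.algebraMap_apply,
      ← Algebra.smul_def]
    rfl
  have : Module.Finite A (integralClosure A (FractionRing A)) := h A ‹_›
  have : Module.Finite A (integralClosure A L) :=
    .equiv (FractionRing.algEquiv A L).mapIntegralClosure.toLinearEquiv
  have : Module.Finite S (integralClosure A L) := .trans A _
  have hle (x : L) (hx : IsIntegral A x) : IsIntegral S x := isIntegral_trans x hx
  let φ : integralClosure A L →ₗ[S] integralClosure S L :=
    { toFun x := ⟨x, hle x x.2⟩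
      map_add' _ _ := rfl
      map_smul' _ _ := Subtype.ext (algebraMap_smul _ _ _).symm }
  exact .of_surjective φ fun x ↦ ⟨⟨x, x.2.tower_top⟩, rfl⟩

theorem UniversallyJapanese.isN2 {D S : Type u} [CommRing D] (hD : UniversallyJapanese D)
    [CommRing S] [IsDomain S] [Algebra D S] [Algebra.FiniteType D S] : IsN2 S := by
  refine isN2_of_forall_isN1 fun A _ _ _ _ ↦ ?_
  let : Algebra D A := ((algebraMap S A).comp (algebraMap D S)).toAlgebra
  have : IsScalarTower D S A := .of_algebraMap_eq' rfl
  exact hD A (.trans (S := S) inferInstance inferInstance)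

/-- A Prüfer domain `D` is universally Japanese if and only if for every prime
ideal `𝔭` of `D` and every `n ≥ 0` the polynomial ring `(D/𝔭)[x₁,…,xₙ]` is
N-2. -/
theorem prufer_universallyJapanese_iff_polynomial_quotients_isN2
    (D : Type u) [CommRing D] [IsDomain D] (hD : IsPruferDomain D) :
    UniversallyJapanese D ↔
      ∀ (𝔭 : Ideal D) [𝔭.IsPrime] (n : ℕ),
        IsN2 (MvPolynomial (Fin n) (D ⧸ 𝔭)) :=
  ⟨fun h _ _ _ ↦ h.isN2, fun h ↦ hD.universallyJapanese h⟩
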